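/- Let D₁ and D₂ be central quaternion division algebras (central division algebras of degree 2) over a field k of characteristic different from 2, and let K = k(x) be the rational function field in one variable over k. If the central division K-algebras D₁ ⊗_k K and D₂ ⊗_k K have the same maximal subfields, then D₁ and D₂ are isomorphic as k-algebras. -/

import Mathlib

open scoped TensorProduct

/-- `D` is a central division algebra of degree `n` over `k`: a division ring which is a
`k`-algebra whose center is exactly `k` and whose dimension over `k` is `n ^ 2`. -/
def IsCentralDivisionAlgebraOfDegree (k : Type) [Field k] (n : ℕ) (D : Type)
    [DivisionRing D] [Algebra k D] : Prop :=
  Subalgebra.center k D = ⊥ ∧ Module.finrank k D = n ^ 2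

/-- Two `k`-algebras have the same maximal subfields (relative to the degree `n`):
a field extension `P/k` of degree `n` embeds into one if and only if it embeds
into the other. -/
def HaveSameMaximalSubfields (k : Type) [Field k] (n : ℕ)
    (D₁ : Type) [Ring D₁] [Algebra k D₁] (D₂ : Type) [Ring D₂] [Algebra k D₂] : Prop :=
  ∀ (P : Type) [Field P] [Algebra k P], Module.finrank k P = n →
    (Nonempty (P →ₐ[k] D₁) ↔ Nonempty (P →ₐ[k] D₂))



section CentralDivisionAlgebra

open Polynomial Quaternion

variable {k D : Type} [Field k] [DivisionRing D] [Algebra k D]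

/-- The evaluation map from `k[t] / (minpoly k y)` to a not necessarily commutative algebra. -/
noncomputable def adjoinRootMinpolyHom (k : Type) {D : Type} [Field k] [DivisionRing D]
    [Algebra k D] (y : D) : AdjoinRoot (minpoly k y) →ₐ[k] D :=
  Ideal.Quotient.liftₐ (Ideal.span {minpoly k y}) (aeval y) <| by
    intro f hf
    obtain ⟨g, rfl⟩ := Ideal.mem_span_singleton.mp hf
    simp

theorem IsCentralDivisionAlgebraOfDegree.exists_algebraMap_eq_of_commute {n : ℕ}
    (hD : IsCentralDivisionAlgebraOfDegree k n D) {z : D} (hz : ∀ y, y * z = z * y) :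
    ∃ c : k, algebraMap k D c = z := by
  have : z ∈ Subalgebra.center k D := Subalgebra.mem_center_iff.mpr hz
  rwa [hD.1] at this

theorem IsCentralDivisionAlgebraOfDegree.exists_sq_eq
    (hD : IsCentralDivisionAlgebraOfDegree k 2 D) (y : D) :
    ∃ p q : k, y * y = p • y + q • (1 : D) := by
  have hfin : FiniteDimensional k D := Module.finite_of_finrank_pos (by rw [hD.2]; norm_num)
  have hy : IsIntegral k y := IsIntegral.of_finite k y
  have : Fact (Irreducible (minpoly k y)) := ⟨minpoly.irreducible hy⟩
  let φ := adjoinRootMinpolyHom k y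
  have hφ : Function.Injective φ := φ.toRingHom.injective
  have hrank : Module.finrank k (AdjoinRoot (minpoly k y)) = (minpoly k y).natDegree :=
    (AdjoinRoot.powerBasis (minpoly.ne_zero hy)).finrank.trans
      (AdjoinRoot.powerBasis_dim (minpoly.ne_zero hy))
  have hdvd : (minpoly k y).natDegree ∣ 4 := by
    let : Module (AdjoinRoot (minpoly k y)) D := Module.compHom D φ.toRingHom
    have : IsScalarTower k (AdjoinRoot (minpoly k y)) D := ⟨fun a b d => by
      change φ (a • b) * d = a • (φ b * d)
      rw [map_smul, smul_mul_assoc]⟩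
    refine ⟨Module.finrank (AdjoinRoot (minpoly k y)) D, ?_⟩
    rw [← hrank, Module.finrank_mul_finrank, hD.2]
    norm_num
  have hne : (minpoly k y).natDegree ≠ 4 := by
    intro h4
    have hfinP : FiniteDimensional k (AdjoinRoot (minpoly k y)) :=
      Module.finite_of_finrank_pos (by rw [hrank, h4]; norm_num)
    have hsurj : Function.Surjective φ :=
      (LinearMap.injective_iff_surjective_of_finrank_eq_finrank (f := φ.toLinearMap)
        (by rw [hrank, h4, hD.2]; norm_num)).mp hφ
    have hcomm : ∀ a b : D, a * b = b * a := by
      intro a b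
      obtain ⟨a, rfl⟩ := hsurj a
      obtain ⟨b, rfl⟩ := hsurj b
      rw [← map_mul, mul_comm, map_mul]
    have htop : (⊥ : Subalgebra k D) = ⊤ := by
      rw [← hD.1, eq_top_iff]
      exact fun z _ => Subalgebra.mem_center_iff.mpr fun b => hcomm b z
    have h1 : Module.finrank k (⊥ : Subalgebra k D) = 2 ^ 2 := by
      rw [htop, ← hD.2]
      exact Subalgebra.topEquiv.toLinearEquiv.finrank_eq
    rw [Subalgebra.finrank_bot] at h1
    norm_num at h1
  have hmonic := minpoly.monic hy
  have heval := minpoly.aeval k y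
  have hcases : (minpoly k y).natDegree = 1 ∨ (minpoly k y).natDegree = 2 := by
    have := Nat.le_of_dvd (by norm_num) hdvd
    interval_cases (minpoly k y).natDegree <;> simp_all
  rcases hcases with h | h
  · rw [Polynomial.aeval_eq_sum_range, h] at heval
    have hc : (minpoly k y).coeff 1 = 1 := by rw [← h]; exact hmonic
    simp only [Finset.sum_range_succ, Finset.sum_range_zero, hc, pow_zero, pow_one, one_smul,
      zero_add] at heval
    refine ⟨-(minpoly k y).coeff 0, 0, ?_⟩
    have : y = (-(minpoly k y).coeff 0) • (1 : D) := by
      rw [neg_smul]; exact eq_neg_of_add_eq_zero_right heval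
    rw [zero_smul, add_zero]
    nth_rewrite 1 [this]
    rw [smul_mul_assoc, one_mul]
  · rw [Polynomial.aeval_eq_sum_range, h] at heval
    have hc : (minpoly k y).coeff 2 = 1 := by rw [← h]; exact hmonic
    simp only [Finset.sum_range_succ, Finset.sum_range_zero, hc, pow_zero, pow_one, one_smul,
      zero_add] at heval
    refine ⟨-(minpoly k y).coeff 1, -(minpoly k y).coeff 0, ?_⟩
    rw [← pow_two, eq_neg_of_add_eq_zero_right heval]
    module

/-- A quaternion division algebra in characteristic not two contains anticommuting noncentral
elements with scalar squares. -/
theorem IsCentralDivisionAlgebraOfDegree.exists_anticommuting (h2 : (2 : k) ≠ 0)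
    (hD : IsCentralDivisionAlgebraOfDegree k 2 D) :
    ∃ (a b : k) (i j : D), i * i = a • (1 : D) ∧ j * j = b • (1 : D) ∧ j * i = -(i * j) ∧
      i ≠ 0 ∧ j ≠ 0 := by
  have h2D : (2 : D) ≠ 0 := by
    have := (map_ne_zero (algebraMap k D)).mpr h2
    rwa [map_ofNat] at this
  obtain ⟨y, hy⟩ : ∃ y : D, y ∉ (⊥ : Subalgebra k D) := by
    by_contra! h
    have htop : (⊥ : Subalgebra k D) = ⊤ := eq_top_iff.mpr fun z _ => h z
    have h1 : Module.finrank k (⊥ : Subalgebra k D) = 2 ^ 2 := by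
      rw [htop, ← hD.2]
      exact Subalgebra.topEquiv.toLinearEquiv.finrank_eq
    rw [Subalgebra.finrank_bot] at h1
    norm_num at h1
  obtain ⟨p, q, hpq⟩ := hD.exists_sq_eq y
  obtain ⟨i, hi⟩ : ∃ i : D, i = y - (p / 2) • (1 : D) := ⟨_, rfl⟩
  obtain ⟨a, ha⟩ : ∃ a : k, i * i = a • (1 : D) := by
    refine ⟨q + (p / 2) * (p / 2), ?_⟩
    have hp : p • y = (p / 2) • y + (p / 2) • y := by 
      rw [← add_smul, ← two_mul, mul_div_cancel₀ _ h2]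
    rw [hi]
    simp only [sub_mul, mul_sub, smul_mul_assoc, mul_smul_comm, one_mul, mul_one, hpq, hp]
    module
  have hi_not : i ∉ (⊥ : Subalgebra k D) := by
    intro h
    apply hy
    have : y = i + (p / 2) • (1 : D) := by rw [hi]; abel
    rw [this]
    exact add_mem h (Subalgebra.smul_mem _ (one_mem _) _)
  have hi0 : i ≠ 0 := fun h => hi_not (h ▸ zero_mem _)
  obtain ⟨z, hz⟩ : ∃ z, z * i ≠ i * z := by
    by_contra! h
    obtain ⟨c, hc⟩ := hD.exists_algebraMap_eq_of_commute h
    exact hi_not (hc ▸ Subalgebra.algebraMap_mem _ c)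
  obtain ⟨j, hj⟩ : ∃ j : D, j = i * z - z * i := ⟨_, rfl⟩
  have hj0 : j ≠ 0 := by rw [hj]; exact sub_ne_zero.mpr hz.symm
  have hji : j * i = -(i * j) := by
    have h1 : i * i * z = z * (i * i) := by rw [ha, smul_mul_assoc, mul_smul_comm, one_mul, mul_one]
    have h2 : j * i + i * j = i * i * z - z * (i * i) := by rw [hj]; noncomm_ring
    rw [h1, sub_self] at h2
    exact eq_neg_of_add_eq_zero_left h2
  obtain ⟨r, s, hrs⟩ := hD.exists_sq_eq j
  have hcomm : i * (j * j) = j * j * i := by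
    rw [mul_assoc, hji, mul_neg, ← mul_assoc j, hji, neg_mul, neg_neg, mul_assoc]
  have hr : r = 0 := by
    rw [hrs, mul_add, add_mul, mul_smul_comm, mul_smul_comm, smul_mul_assoc, smul_mul_assoc,
      one_mul, mul_one, add_left_inj, hji, smul_neg] at hcomm
    have h3 : (2 * r) • (i * j) = 0 := by
      rw [two_mul, add_smul]
      nth_rewrite 1 [hcomm]
      simp
    rcases smul_eq_zero.mp h3 with h | h
    · exact (mul_eq_zero.mp h).resolve_left h2
    · exact absurd h (mul_ne_zero hi0 hj0)
  exact ⟨a, s, i, j, ha, by rw [hrs, hr, zero_smul, zero_add], hji, hi0, hj0⟩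

/-- The quaternionic basis determined by two anticommuting elements. -/
def quaternionBasisOfAnticommuting {R A : Type} [CommRing R] [Ring A] [Algebra R A] {a b : R}
    {i j : A} (hi : i * i = a • (1 : A)) (hj : j * j = b • (1 : A)) (hji : j * i = -(i * j)) :
    QuaternionAlgebra.Basis A a 0 b where
  i := i
  j := j
  k := i * j
  i_mul_i := by rw [hi, zero_smul, add_zero]
  j_mul_j := hj
  i_mul_j := rfl
  j_mul_i := by rw [hji, zero_smul, zero_sub]

theorem quaternionBasis_liftHom_injective (h2 : (2 : k) ≠ 0) {a b : k}
    (B : QuaternionAlgebra.Basis D a 0 b) (hi : B.i ≠ 0) (hj : B.j ≠ 0) :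
    Function.Injective B.liftHom := by
  rw [injective_iff_map_eq_zero]
  rintro ⟨t, u, v, w⟩ h
  have h2D : (2 : D) ≠ 0 := by
    have := (map_ne_zero (algebraMap k D)).mpr h2
    rwa [map_ofNat] at this
  have hji : B.j * B.i = -(B.i * B.j) := by rw [B.j_mul_i, B.i_mul_j, zero_smul, zero_sub]
  simp only [QuaternionAlgebra.Basis.liftHom_apply, QuaternionAlgebra.Basis.lift,
    Algebra.algebraMap_eq_smul_one, ← B.i_mul_j] at h
  have split : ∀ α β : k, α • (1 : D) + β • B.i = 0 → α = 0 ∧ β = 0 := by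
    intro α β h
    have h1 : (α • (1 : D) - β • B.i) * B.j = 0 := by
      have : (α • (1 : D) - β • B.i) * B.j = B.j * (α • (1 : D) + β • B.i) := by
        simp only [sub_mul, mul_add, smul_mul_assoc, mul_smul_comm, one_mul, mul_one, hji]
        module
      rw [this, h, mul_zero]
    have h3 := (mul_eq_zero.mp h1).resolve_right hj
    have hα : (2 * α) • (1 : D) = 0 := by linear_combination (norm := module) h + h3
    have hα0 : α = 0 := by simpa [h2] using hα
    refine ⟨hα0, ?_⟩
    rw [hα0, zero_smul, zero_add] at h
    exact (smul_eq_zero.mp h).resolve_right hi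
  obtain ⟨X, hX⟩ : ∃ X, X = t • (1 : D) + u • B.i := ⟨_, rfl⟩
  obtain ⟨Y, hY⟩ : ∃ Y, Y = v • (1 : D) + w • B.i := ⟨_, rfl⟩
  have hXi : B.i * X = X * B.i := by rw [hX]; simp [mul_add, add_mul]
  have hYi : B.i * Y = Y * B.i := by rw [hY]; simp [mul_add, add_mul]
  have hXY : X + Y * B.j = 0 := by
    rw [← h, hX, hY, add_mul, smul_mul_assoc, smul_mul_assoc, one_mul]
    abel
  have hXY' : X - Y * B.j = 0 := by
    have : (X - Y * B.j) * B.i = B.i * (X + Y * B.j) := by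
      rw [sub_mul, mul_add, mul_assoc, hji, mul_neg, sub_neg_eq_add, hXi, ← mul_assoc B.i, hYi,
        mul_assoc]
    rw [hXY, mul_zero] at this
    exact (mul_eq_zero.mp this).resolve_right hi
  have hX0 : X = 0 := by
    have : 2 * X = 0 := by rw [two_mul]; linear_combination (norm := abel) hXY + hXY'
    exact (mul_eq_zero.mp this).resolve_left h2D
  have hY0 : Y = 0 := by
    rw [hX0, zero_add] at hXY
    exact (mul_eq_zero.mp hXY).resolve_right hj
  obtain ⟨rfl, rfl⟩ := split t u (hX ▸ hX0)
  obtain ⟨rfl, rfl⟩ := split v w (hY ▸ hY0)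
  rfl

theorem IsCentralDivisionAlgebraOfDegree.bijective_liftHom (h2 : (2 : k) ≠ 0)
    (hD : IsCentralDivisionAlgebraOfDegree k 2 D) {a b : k}
    (B : QuaternionAlgebra.Basis D a 0 b) (hi : B.i ≠ 0) (hj : B.j ≠ 0) :
    Function.Bijective B.liftHom := by
  have hinj := quaternionBasis_liftHom_injective h2 B hi hj
  have hfin : FiniteDimensional k D := Module.finite_of_finrank_pos (by rw [hD.2]; norm_num)
  exact ⟨hinj, (LinearMap.injective_iff_surjective_of_finrank_eq_finrank
    (f := B.liftHom.toLinearMap)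
    (by rw [QuaternionAlgebra.finrank_eq_four, hD.2]; norm_num)).mp hinj⟩

end CentralDivisionAlgebra

section CasselsPfister

open Polynomial

/-- The diagonal ternary quadratic form with coefficients `α`, `β`, `γ`. -/
def ternaryForm {R : Type} [CommRing R] (α β γ x y z : R) : R :=
  α * x ^ 2 + β * y ^ 2 + γ * z ^ 2

/-- A diagonal ternary quadratic form is anisotropic if it has no nontrivial zero. -/
def TernaryAnisotropic {R : Type} [CommRing R] (α β γ : R) : Prop :=
  ∀ x y z : R, ternaryForm α β γ x y z = 0 → x = 0 ∧ y = 0 ∧ z = 0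

variable {k : Type} [Field k] {α β γ : k}

theorem coeff_ternaryForm {m : ℕ} {x y z : k[X]} (hx : x.natDegree ≤ m) (hy : y.natDegree ≤ m)
    (hz : z.natDegree ≤ m) :
    (ternaryForm (C α) (C β) (C γ) x y z).coeff (2 * m) =
      ternaryForm α β γ (x.coeff m) (y.coeff m) (z.coeff m) := by
  simp only [ternaryForm, coeff_add, coeff_C_mul, coeff_pow_of_natDegree_le hx,
    coeff_pow_of_natDegree_le hy, coeff_pow_of_natDegree_le hz]

theorem natDegree_ternaryForm_le {m : ℕ} {x y z : k[X]} (hx : x.natDegree ≤ m)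
    (hy : y.natDegree ≤ m) (hz : z.natDegree ≤ m) :
    (ternaryForm (C α) (C β) (C γ) x y z).natDegree ≤ 2 * m := by
  have key : ∀ (a : k) (w : k[X]), w.natDegree ≤ m → (C a * w ^ 2).natDegree ≤ 2 * m :=
    fun a w hw => (natDegree_C_mul_le _ _).trans (natDegree_pow_le_of_le 2 hw)
  exact natDegree_add_le_of_degree_le
    (natDegree_add_le_of_degree_le (key _ _ hx) (key _ _ hy)) (key _ _ hz)

theorem TernaryAnisotropic.natDegree_le (h : TernaryAnisotropic α β γ) {n : ℕ} {x y z : k[X]}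
    (hdeg : (ternaryForm (C α) (C β) (C γ) x y z).natDegree ≤ 2 * n) :
    x.natDegree ≤ n ∧ y.natDegree ≤ n ∧ z.natDegree ≤ n := by
  obtain ⟨m, hm⟩ : ∃ m, m = max x.natDegree (max y.natDegree z.natDegree) := ⟨_, rfl⟩
  suffices m ≤ n by omega
  by_contra! hlt
  have hx : x.natDegree ≤ m := by omega
  have hy : y.natDegree ≤ m := by omega
  have hz : z.natDegree ≤ m := by omega
  obtain ⟨h1, h2, h3⟩ := h _ _ _ ((coeff_ternaryForm hx hy hz).symm.trans
    (coeff_eq_zero_of_natDegree_lt (by omega)))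
  have key : ∀ w : k[X], w.coeff m = 0 → w.natDegree ≠ m := by
    intro w hw h
    rw [← h, coeff_natDegree, leadingCoeff_eq_zero] at hw
    rw [hw, natDegree_zero] at h
    omega
  have := key _ h1
  have := key _ h2
  have := key _ h3
  omega

theorem TernaryAnisotropic.polynomial (h : TernaryAnisotropic α β γ) :
    TernaryAnisotropic (C α) (C β) (C γ) := by
  intro x y z h0
  obtain ⟨hx, hy, hz⟩ := h.natDegree_le (n := 0) (x := x) (y := y) (z := z) (by simp [h0])
  obtain ⟨h1, h2, h3⟩ := h _ _ _ ((coeff_ternaryForm hx hy hz).symm.trans (by simp [h0]))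
  refine ⟨?_, ?_, ?_⟩
  · rw [eq_C_of_natDegree_le_zero hx, h1, C_0]
  · rw [eq_C_of_natDegree_le_zero hy, h2, C_0]
  · rw [eq_C_of_natDegree_le_zero hz, h3, C_0]

/-- The Cassels–Pfister theorem for diagonal ternary forms, with denominators cleared. -/
theorem TernaryAnisotropic.exists_eq_of_eq_mul_sq (h : TernaryAnisotropic α β γ) (p : k[X]) :
    ∀ (n : ℕ) (x y z t : k[X]), t.natDegree = n → t ≠ 0 →
      ternaryForm (C α) (C β) (C γ) x y z = p * t ^ 2 →
      ∃ x' y' z' : k[X], ternaryForm (C α) (C β) (C γ) x' y' z' = p := by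
  intro n
  induction n using Nat.strong_induction_on with
  | _ n ih =>
    intro x y z t hn ht hxyz
    obtain ⟨x₁, x₂, hx, hx₂⟩ : ∃ q r, x = t * q + r ∧ r.degree < t.degree :=
      ⟨x / t, x % t, (EuclideanDomain.div_add_mod x t).symm, degree_mod_lt x ht⟩
    obtain ⟨y₁, y₂, hy, hy₂⟩ : ∃ q r, y = t * q + r ∧ r.degree < t.degree :=
      ⟨y / t, y % t, (EuclideanDomain.div_add_mod y t).symm, degree_mod_lt y ht⟩
    obtain ⟨z₁, z₂, hz, hz₂⟩ : ∃ q r, z = t * q + r ∧ r.degree < t.degree :=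
      ⟨z / t, z % t, (EuclideanDomain.div_add_mod z t).symm, degree_mod_lt z ht⟩
    subst hx hy hz
    by_cases hr : x₂ = 0 ∧ y₂ = 0 ∧ z₂ = 0
    · obtain ⟨rfl, rfl, rfl⟩ := hr
      refine ⟨x₁, y₁, z₁, mul_right_cancel₀ (pow_ne_zero 2 ht) ?_⟩
      rw [← hxyz]
      simp only [ternaryForm]
      ring
    · obtain ⟨s, hs⟩ : ∃ s, s = t * p - 2 * (C α * (t * x₁ + x₂) * x₁ + C β * (t * y₁ + y₂) * y₁ +
          C γ * (t * z₁ + z₂) * z₁) + t * ternaryForm (C α) (C β) (C γ) x₁ y₁ z₁ := ⟨_, rfl⟩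
      have hst : ternaryForm (C α) (C β) (C γ) x₂ y₂ z₂ = s * t := by
        rw [hs]
        simp only [ternaryForm] at hxyz ⊢
        linear_combination hxyz
      have hne : ternaryForm (C α) (C β) (C γ) x₂ y₂ z₂ ≠ 0 := fun h0 => hr (h.polynomial _ _ _ h0)
      have hs0 : s ≠ 0 := by
        rintro rfl
        exact hne (by rw [hst, zero_mul])
      have hn0 : 0 < n := by
        rw [← hn]
        by_contra! h0
        have hd : t.degree ≤ 0 := natDegree_eq_zero_iff_degree_le_zero.mp (Nat.le_zero.mp h0)
        have hzero : ∀ w : k[X], w.degree < t.degree → w = 0 := fun w hw =>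
          degree_eq_bot.mp (Nat.WithBot.lt_zero_iff.mp (hw.trans_le hd))
        exact hr ⟨hzero _ hx₂, hzero _ hy₂, hzero _ hz₂⟩
      have hle : ∀ w : k[X], w.degree < t.degree → w.natDegree ≤ n - 1 := by
        intro w hw
        by_cases hw0 : w = 0
        · simp [hw0]
        · have := natDegree_lt_natDegree hw0 hw
          omega
      have hdeg := natDegree_ternaryForm_le (α := α) (β := β) (γ := γ) (hle _ hx₂) (hle _ hy₂)
        (hle _ hz₂)
      rw [hst, natDegree_mul hs0 ht] at hdeg
      obtain ⟨N, hN⟩ : ∃ N, N = ternaryForm (C α) (C β) (C γ) x₁ y₁ z₁ - p := ⟨_, rfl⟩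
      refine ih s.natDegree (by omega) (s * x₁ + N * x₂) (s * y₁ + N * y₂) (s * z₁ + N * z₂) s rfl
        hs0 ?_
      have hB : s + 2 * (C α * x₂ * x₁ + C β * y₂ * y₁ + C γ * z₂ * z₁) + N * t = 0 := by
        rw [hs, hN]
        simp only [ternaryForm]
        ring
      have hexp : ternaryForm (C α) (C β) (C γ) (s * x₁ + N * x₂) (s * y₁ + N * y₂)
          (s * z₁ + N * z₂) = s ^ 2 * (N + p) +
            2 * s * N * (C α * x₂ * x₁ + C β * y₂ * y₁ + C γ * z₂ * z₁) +
            N ^ 2 * ternaryForm (C α) (C β) (C γ) x₂ y₂ z₂ := by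
        have hNp : N + p = ternaryForm (C α) (C β) (C γ) x₁ y₁ z₁ := by rw [hN]; ring
        rw [hNp]
        simp only [ternaryForm]
        ring
      rw [hexp, hst]
      linear_combination s * N * hB

/-- The Cassels–Pfister theorem for anisotropic diagonal ternary forms. -/
theorem TernaryAnisotropic.exists_eq_of_ratFunc (h : TernaryAnisotropic α β γ) (p : k[X])
    {x y z : RatFunc k}
    (hxyz : ternaryForm (algebraMap k (RatFunc k) α) (algebraMap k (RatFunc k) β)
      (algebraMap k (RatFunc k) γ) x y z = algebraMap k[X] (RatFunc k) p) :
    ∃ x' y' z' : k[X], ternaryForm (C α) (C β) (C γ) x' y' z' = p := by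
  obtain ⟨x₁, x₂, hx₂, rfl⟩ := IsFractionRing.div_surjective k[X] x
  obtain ⟨y₁, y₂, hy₂, rfl⟩ := IsFractionRing.div_surjective k[X] y
  obtain ⟨z₁, z₂, hz₂, rfl⟩ := IsFractionRing.div_surjective k[X] z
  have hx := nonZeroDivisors.ne_zero hx₂
  have hy := nonZeroDivisors.ne_zero hy₂
  have hz := nonZeroDivisors.ne_zero hz₂
  refine h.exists_eq_of_eq_mul_sq p _ (x₁ * y₂ * z₂) (y₁ * x₂ * z₂) (z₁ * x₂ * y₂) (x₂ * y₂ * z₂)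
    rfl (mul_ne_zero (mul_ne_zero hx hy) hz) (RatFunc.algebraMap_injective k ?_)
  have hx' := RatFunc.algebraMap_ne_zero hx
  have hy' := RatFunc.algebraMap_ne_zero hy
  have hz' := RatFunc.algebraMap_ne_zero hz
  simp only [ternaryForm, map_add, map_mul, map_pow] at hxyz ⊢
  rw [← hxyz]
  have hC : ∀ a : k, algebraMap k[X] (RatFunc k) (C a) = algebraMap k (RatFunc k) a := fun a =>
    (IsScalarTower.algebraMap_apply k k[X] (RatFunc k) a).symm
  simp only [hC]
  field_simp

/-- If an anisotropic form represents `a + b X²` over `k(X)`, then it has orthogonal vectors over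
`k` representing `a` and `b`. -/
theorem TernaryAnisotropic.exists_orthogonal (h2 : (2 : k) ≠ 0) (h : TernaryAnisotropic α β γ)
    {a b : k} {x y z : RatFunc k}
    (hxyz : ternaryForm (algebraMap k (RatFunc k) α) (algebraMap k (RatFunc k) β)
      (algebraMap k (RatFunc k) γ) x y z = algebraMap k[X] (RatFunc k) (C a + C b * X ^ 2)) :
    ∃ x₀ y₀ z₀ x₁ y₁ z₁ : k, ternaryForm α β γ x₀ y₀ z₀ = a ∧ ternaryForm α β γ x₁ y₁ z₁ = b ∧
      α * x₀ * x₁ + β * y₀ * y₁ + γ * z₀ * z₁ = 0 := by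
  obtain ⟨x, y, z, hp⟩ := h.exists_eq_of_ratFunc _ hxyz
  obtain ⟨hx, hy, hz⟩ := h.natDegree_le (n := 1) (x := x) (y := y) (z := z) (by
    rw [hp]; compute_degree)
  refine ⟨x.coeff 0, y.coeff 0, z.coeff 0, x.coeff 1, y.coeff 1, z.coeff 1, ?_, ?_, ?_⟩
  · have := congrArg (coeff · 0) hp
    simpa [ternaryForm, mul_coeff_zero, pow_two] using this
  · rw [← coeff_ternaryForm hx hy hz, hp]
    simp [coeff_X_pow]
  · have := congrArg (coeff · 1) hp
    simp only [ternaryForm, coeff_add, pow_two, mul_coeff_one] at this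
    simp [coeff_C, coeff_X] at this
    refine (mul_eq_zero.mp ?_).resolve_left h2
    linear_combination this

end CasselsPfister

section Quaternion

open Polynomial Quaternion

variable {k D : Type} [Field k] [DivisionRing D] [Algebra k D]

theorem quaternionBasis_ternaryAnisotropic (h2 : (2 : k) ≠ 0) {a b : k}
    (B : QuaternionAlgebra.Basis D a 0 b) (hi : B.i ≠ 0) (hj : B.j ≠ 0) :
    TernaryAnisotropic a b (-(a * b)) := by
  intro x y z h
  have hsq : (⟨0, x, y, z⟩ : ℍ[k,a,0,b]) * ⟨0, x, y, z⟩ = 0 := by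
    simp only [ternaryForm] at h
    ext <;> simp
    all_goals first | linear_combination h | ring
  have h0 : B.liftHom ⟨0, x, y, z⟩ = 0 := by
    rw [← mul_self_eq_zero, ← map_mul, hsq, map_zero]
  have := (injective_iff_map_eq_zero _).mp (quaternionBasis_liftHom_injective h2 B hi hj) _ h0
  exact ⟨congrArg QuaternionAlgebra.imI this, congrArg QuaternionAlgebra.imJ this,
    congrArg QuaternionAlgebra.imK this⟩

/-- Extension of scalars of a quaternion algebra, as a map from the tensor product. -/
noncomputable def tensorToQuaternionAlgebra (K : Type) [Field K] [Algebra k K] {a b : k}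
    (e : D ≃ₐ[k] ℍ[k,a,0,b]) :
    K ⊗[k] D →ₐ[K] ℍ[K,algebraMap k K a,0,algebraMap k K b] :=
  Algebra.TensorProduct.lift (Algebra.ofId K _)
    ((quaternionBasisOfAnticommuting (R := k) (a := a) (b := b)
      (A := ℍ[K,algebraMap k K a,0,algebraMap k K b]) (i := ⟨0, 1, 0, 0⟩) (j := ⟨0, 0, 1, 0⟩)
      (by ext <;> simp [Algebra.algebraMap_eq_smul_one]) (by ext <;> simp [Algebra.algebraMap_eq_smul_one])
      (by ext <;> simp)).liftHom.comp e.toAlgHom)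
    (fun _ _ => Algebra.commutes _ _)

theorem ternaryForm_eq_of_mul_self_eq {K : Type} [Field K] (h2 : (2 : K) ≠ 0) {a b f : K}
    (hf : ∀ r, r ^ 2 ≠ f) {w : ℍ[K,a,0,b]} (hw : w * w = f • 1) :
    ternaryForm a b (-(a * b)) w.imI w.imJ w.imK = f := by
  obtain ⟨t, x, y, z⟩ := w
  have h0 := congrArg QuaternionAlgebra.re hw
  have hx := congrArg QuaternionAlgebra.imI hw
  have hy := congrArg QuaternionAlgebra.imJ hw
  have hz := congrArg QuaternionAlgebra.imK hw
  simp at h0 hx hy hz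
  by_cases ht : t = 0
  · subst ht
    simp only [ternaryForm]
    linear_combination h0
  · have h2t : 2 * t ≠ 0 := mul_ne_zero h2 ht
    have hx0 : x = 0 := (mul_eq_zero.mp (by linear_combination hx)).resolve_left h2t
    have hy0 : y = 0 := (mul_eq_zero.mp (by linear_combination hy)).resolve_left h2t
    have hz0 : z = 0 := (mul_eq_zero.mp (by linear_combination hz)).resolve_left h2t
    subst hx0 hy0 hz0
    exact absurd (by linear_combination h0) (hf t)

theorem sq_ne_C_add_C_mul_X_sq (h2 : (2 : k) ≠ 0) {a b : k} (ha : a ≠ 0) (hb : b ≠ 0)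
    (r : RatFunc k) : r ^ 2 ≠ algebraMap k[X] (RatFunc k) (C a + C b * X ^ 2) := by
  intro hr
  have hint : IsIntegral k[X] r := by
    refine IsIntegral.of_pow (n := 2) (by norm_num) ?_
    rw [hr]
    exact isIntegral_algebraMap
  obtain ⟨g, rfl⟩ := IsIntegrallyClosed.isIntegral_iff.mp hint
  rw [← map_pow] at hr
  have hg := RatFunc.algebraMap_injective k hr
  have hdeg : g.natDegree ≤ 1 := by
    have h : (g ^ 2).natDegree ≤ 2 := by rw [hg]; compute_degree
    rw [natDegree_pow] at h
    omega
  have c0 := congrArg (coeff · 0) hg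
  have c1 := congrArg (coeff · 1) hg
  have c2 : (g ^ 2).coeff (2 * 1) = g.coeff 1 ^ 2 := coeff_pow_of_natDegree_le hdeg
  rw [hg] at c2
  simp [coeff_X_pow] at c2
  simp [pow_two, mul_coeff_zero] at c0
  simp [pow_two, mul_coeff_one, coeff_C, coeff_X] at c1
  have h01 : g.coeff 0 * g.coeff 1 = 0 :=
    (mul_eq_zero.mp (by linear_combination c1)).resolve_left h2
  rcases mul_eq_zero.mp h01 with h | h
  · exact ha (by rw [← c0, h, mul_zero])
  · exact hb (by rw [c2, h]; ring)

end Quaternion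

/-- If two quaternion division algebras over `k` (`char k ≠ 2`) become algebras with the same
maximal subfields over the rational function field `K = k(x)`, then they are already
isomorphic over `k`. -/
theorem quaternion_algebras_isomorphic_of_same_maximal_subfields_over_ratFunc
    (k : Type) [Field k] (hchar : ringChar k ≠ 2)
    (D₁ : Type) [DivisionRing D₁] [Algebra k D₁]
    (hD₁ : IsCentralDivisionAlgebraOfDegree k 2 D₁)
    (D₂ : Type) [DivisionRing D₂] [Algebra k D₂]
    (hD₂ : IsCentralDivisionAlgebraOfDegree k 2 D₂)
    (hsame : HaveSameMaximalSubfields (RatFunc k) 2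
      (RatFunc k ⊗[k] D₁) (RatFunc k ⊗[k] D₂)) :
    Nonempty (D₁ ≃ₐ[k] D₂) := by
  have h2 : (2 : k) ≠ 0 := Ring.two_ne_zero hchar
  have h2K : (2 : RatFunc k) ≠ 0 := by
    have := (map_ne_zero (algebraMap k (RatFunc k))).mpr h2
    rwa [map_ofNat] at this
  obtain ⟨a, b, i, j, hi, hj, hji, hi0, hj0⟩ := hD₁.exists_anticommuting h2
  obtain ⟨c, d, i', j', hi', hj', hji', hi0', hj0'⟩ := hD₂.exists_anticommuting h2
  have ha : a ≠ 0 := by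
    rintro rfl
    rw [zero_smul] at hi
    exact hi0 (mul_self_eq_zero.mp hi)
  have hb : b ≠ 0 := by
    rintro rfl
    rw [zero_smul] at hj
    exact hj0 (mul_self_eq_zero.mp hj)
  let B₁ := quaternionBasisOfAnticommuting hi hj hji
  let B₂ := quaternionBasisOfAnticommuting hi' hj' hji'
  let e₁ := AlgEquiv.ofBijective B₁.liftHom (hD₁.bijective_liftHom h2 B₁ hi0 hj0)
  let e₂ := AlgEquiv.ofBijective B₂.liftHom (hD₂.bijective_liftHom h2 B₂ hi0' hj0')
  let X : RatFunc k := RatFunc.X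
  obtain ⟨f, hf⟩ : ∃ f, f = algebraMap (Polynomial k) (RatFunc k)
    (Polynomial.C a + Polynomial.C b * Polynomial.X ^ 2) := ⟨_, rfl⟩
  have hfX : f = a • (1 : RatFunc k) + b • (X * X) := by
    rw [hf, map_add, map_mul, map_pow, RatFunc.algebraMap_X, RatFunc.algebraMap_C,
      RatFunc.algebraMap_C, Algebra.smul_def, Algebra.smul_def, mul_one, pow_two]
    rfl
  have hsq : ∀ r, r ^ 2 ≠ f := fun r => hf ▸ sq_ne_C_add_C_mul_X_sq h2 ha hb r
  have : Fact (∀ r, r ^ 2 ≠ f + 0 * r) := ⟨by simpa using hsq⟩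
  obtain ⟨u, hu⟩ : ∃ u : RatFunc k ⊗[k] D₁, u * u = f • 1 := by
    refine ⟨1 ⊗ₜ i + X ⊗ₜ j, ?_⟩
    have hf1 : f • (1 : RatFunc k ⊗[k] D₁) = 1 ⊗ₜ (a • 1) + (X * X) ⊗ₜ (b • 1) := by
      rw [Algebra.TensorProduct.one_def, TensorProduct.smul_tmul', smul_eq_mul, mul_one, hfX,
        TensorProduct.add_tmul, TensorProduct.smul_tmul, TensorProduct.smul_tmul]
    simp only [hf1, mul_add, add_mul, Algebra.TensorProduct.tmul_mul_tmul, hi, hj, hji, one_mul,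
      mul_one, TensorProduct.tmul_neg]
    abel
  obtain ⟨ψ⟩ := (hsame (QuadraticAlgebra (RatFunc k) f 0) (QuadraticAlgebra.finrank_eq_two _ _)).mp
    ⟨QuadraticAlgebra.lift ⟨u, by rw [hu, zero_smul, add_zero]⟩⟩
  let θ := (tensorToQuaternionAlgebra (RatFunc k) e₂.symm).comp ψ
  have hw : θ QuadraticAlgebra.omega * θ QuadraticAlgebra.omega = f • 1 := by
    rw [← map_mul, QuadraticAlgebra.omega_mul_omega_eq_add, zero_smul, add_zero, map_smul, map_one]
  have hform := (ternaryForm_eq_of_mul_self_eq h2K hsq hw).trans hf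
  rw [← map_mul, ← map_neg] at hform
  obtain ⟨x₀, y₀, z₀, x₁, y₁, z₁, h₀, h₁, h₀₁⟩ :=
    (quaternionBasis_ternaryAnisotropic h2 B₂ hi0' hj0').exists_orthogonal h2 hform
  simp only [ternaryForm] at h₀ h₁
  let v : QuaternionAlgebra k c 0 d := ⟨0, x₀, y₀, z₀⟩
  let w : QuaternionAlgebra k c 0 d := ⟨0, x₁, y₁, z₁⟩
  have hv : v * v = a • 1 := by
    ext <;> simp [v]
    all_goals first | linear_combination h₀ | ring
  have hw : w * w = b • 1 := by
    ext <;> simp [w]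
    all_goals first | linear_combination h₁ | ring
  have hwv : w * v = -(v * w) := by
    ext <;> simp [v, w]
    all_goals first | linear_combination 2 * h₀₁ | ring
  let B := (quaternionBasisOfAnticommuting hv hw hwv).compHom e₂.toAlgHom
  have hBi : B.i ≠ 0 := by
    intro h
    have := B.i_mul_i
    rw [h, mul_zero, smul_zero, add_zero, eq_comm, smul_eq_zero] at this
    simp [ha] at this
  have hBj : B.j ≠ 0 := by
    intro h
    have := B.j_mul_j
    rw [h, mul_zero, eq_comm, smul_eq_zero] at this
    simp [hb] at this
  exact ⟨e₁.symm.trans (AlgEquiv.ofBijective B.liftHom (hD₂.bijective_liftHom h2 B hBi hBj))⟩
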